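/- arXiv:2510.25455 — 2 statements merged into one kernel-verified Lean document; each statement's English description precedes it below -/
import Mathlib

section
/- Let A be an at most countable-dimensional associative unital algebra over a field K admitting a simple module M with trivial annihilator and End_A(M) = K. Then for every finite-dimensional nonzero subspace V ⊆ A of dimension d there exist nonzero elements a_1, …, a_d ∈ A such that every two-sided ideal I of A with I ∩ V ≠ 0 contains some a_i. -/
theorem aux_indep {K A M : Type*} [Field K] [Ring A] [Algebra K A]
    [AddCommGroup M] [Module A M] [Module K M] [IsScalarTower K A M]
    (hsimple : IsSimpleModule A M)
    (hfaithful : ∀ a : A, (∀ m : M, a • m = 0) → a = 0)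
    (hend : ∀ f : M →ₗ[A] M, ∃ c : K, ∀ m : M, f m = c • m)
    {d : ℕ} (v : Fin d → A) (hv : LinearIndependent K v) (c : Fin d → A)
    (h : ∀ x : A, ∑ i, v i * (x * c i) = 0) (i : Fin d) : c i = 0 := by
  classical
  apply hfaithful
  intro m
  rw [← Module.forall_dual_apply_eq_zero_iff K]
  intro f
  have key : ∑ j, f (c j • m) • v j = 0 := by
    apply hfaithful
    intro p
    let F : Module.End (Module.End A M) M :=
      { toFun := fun y => f y • p
        map_add' := by intro y z; simp [add_smul]
        map_smul' := by
          intro φ y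
          obtain ⟨k, hk⟩ := hend φ
          simp [hk, mul_smul] }
    obtain ⟨r, hr⟩ := jacobson_density F (Finset.univ.image fun j => c j • m)
    have h1 : (∑ j, v j * (r * c j)) • m = 0 := by rw [h r, zero_smul]
    rw [Finset.sum_smul] at h1 ⊢
    rw [← h1]
    refine Finset.sum_congr rfl fun j _ => ?_
    have h2 : f (c j • m) • p = r • (c j • m) :=
      hr (c j • m) (Finset.mem_image_of_mem _ (Finset.mem_univ j))
    rw [mul_smul, mul_smul, ← h2, smul_assoc]
    rw [← algebraMap_smul A (f (c j • m)) p, ← mul_smul, ← Algebra.commutes, mul_smul,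
      algebraMap_smul]
  exact (Fintype.linearIndependent_iff.1 hv) _ key i

theorem aux_words {K A M : Type*} [Field K] [Ring A] [Algebra K A]
    [AddCommGroup M] [Module A M] [Module K M] [IsScalarTower K A M]
    (hsimple : IsSimpleModule A M)
    (hfaithful : ∀ a : A, (∀ m : M, a • m = 0) → a = 0)
    (hend : ∀ f : M →ₗ[A] M, ∃ c : K, ∀ m : M, f m = c • m)
    {d : ℕ} (v : Fin d → A) (hv : LinearIndependent K v) (n : ℕ) :
    ∀ (α : (Fin n → Fin d) → K),
    (∀ x : Fin n → A, ∑ g, α g • (List.ofFn fun i => v (g i) * x i).prod = 0) →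
    ∀ g, α g = 0 := by
  induction n with
  | zero =>
    intro α h g
    have h0 := h 0
    have : Nontrivial M := IsSimpleModule.nontrivial A M
    have : Nontrivial A := Module.nontrivial A M
    simp at h0
    rw [Subsingleton.elim g]
    exact h0
  | succ n ih =>
    intro α h g
    have key : ∀ (i : Fin d) (g' : Fin n → Fin d), α (Fin.cons i g') = 0 := by
      intro i
      apply ih
      intro x
      refine aux_indep hsimple hfaithful hend v hv
        (fun i => ∑ g' : Fin n → Fin d, α (Fin.cons i g') •
          (List.ofFn fun j => v (g' j) * x j).prod) ?_ i
      intro y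
      have h1 := h (Fin.cons y x)
      rw [← (Fin.consEquiv fun _ => Fin d).sum_comp, Fintype.sum_prod_type] at h1
      rw [← h1]
      refine Finset.sum_congr rfl fun k _ => ?_
      simp only [Finset.mul_sum]
      refine Finset.sum_congr rfl fun g' _ => ?_
      simp [Fin.consEquiv, List.ofFn_succ, mul_assoc]
    rw [← Fin.cons_self_tail g]
    exact key _ _

theorem aux_mem {A : Type*} [Ring A] (I : TwoSidedIdeal A) (l : List A) (a : A) (ha : a ∈ l)
    (hI : a ∈ I) : l.prod ∈ I := by
  induction l with
  | nil => simp at ha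
  | cons b l ih =>
    rw [List.prod_cons]
    rcases List.mem_cons.1 ha with rfl | h
    · exact I.mul_mem_right _ _ hI
    · exact I.mul_mem_left _ _ (ih h)

theorem stmt_2 {K A M : Type*} [Field K] [Ring A] [Algebra K A]
    [AddCommGroup M] [Module A M] [Module K M] [IsScalarTower K A M]
    (hcount : Module.rank K A ≤ Cardinal.aleph0)
    (hsimple : IsSimpleModule A M)
    (hfaithful : ∀ a : A, (∀ m : M, a • m = 0) → a = 0)
    (hend : ∀ f : M →ₗ[A] M, ∃ c : K, ∀ m : M, f m = c • m)
    (V : Submodule K A) [FiniteDimensional K V] (hV : V ≠ ⊥) :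
    ∃ a : Fin (Module.finrank K V) → A, (∀ i, a i ≠ 0) ∧
      ∀ I : TwoSidedIdeal A, (∃ u ∈ V, u ≠ 0 ∧ u ∈ I) → ∃ i, a i ∈ I := by
  classical
  have b := Module.finBasis K V
  generalize Module.finrank K V = d at b ⊢
  let v : Fin d → A := fun i => (b i : A)
  have hv : LinearIndependent K v :=
    b.linearIndependent.map' V.subtype (Submodule.ker_subtype V)
  let F : (Fin d → A) → MultilinearMap K (fun _ : Fin d => A) A := fun x =>
    (MultilinearMap.mkPiAlgebraFin K d A).compLinearMap fun i => LinearMap.mulRight K (x i)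
  have hF : ∀ x w, F x w = (List.ofFn fun i => w i * x i).prod := by
    intro x w
    simp [F]
  have hex : ∃ x, MultilinearMap.alternatization (F x) v ≠ 0 := by
    by_contra! hcon
    have h1 := aux_words hsimple hfaithful hend v hv d
      (fun g => ∑ σ : Equiv.Perm (Fin d), if (σ : Fin d → Fin d) = g then
        ((Equiv.Perm.sign σ : ℤ) : K) else 0) ?_ id
    · have : ∀ σ : Equiv.Perm (Fin d), ((σ : Fin d → Fin d) = id) ↔ σ = 1 := by
        intro σ
        constructor
        · intro h; ext i; simp [h]
        · rintro rfl; rfl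
      simp [this] at h1
    · intro x
      rw [← hcon x, MultilinearMap.alternatization_apply]
      simp only [Finset.sum_smul, ite_smul, zero_smul]
      rw [Finset.sum_comm]
      refine Finset.sum_congr rfl fun σ _ => ?_
      simp [hF, Units.smul_def, Algebra.smul_def]
  obtain ⟨x, hx⟩ := hex
  refine ⟨fun _ => MultilinearMap.alternatization (F x) v, fun _ => hx, ?_⟩
  rintro I ⟨u, huV, hu0, huI⟩
  have hu : u = ∑ j, b.repr ⟨u, huV⟩ j • v j := by
    have := congrArg (V.subtype) (b.sum_repr ⟨u, huV⟩)
    rw [map_sum] at this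
    simpa using this.symm
  obtain ⟨k, hk⟩ : ∃ k, b.repr ⟨u, huV⟩ k ≠ 0 := by
    by_contra! hcon
    apply hu0
    rw [hu]
    simp [hcon]
  refine ⟨k, ?_⟩
  have h1 : MultilinearMap.alternatization (F x) (Function.update v k u) ∈ I := by
    rw [MultilinearMap.alternatization_apply]
    refine sum_mem fun σ _ => ?_
    rw [Units.smul_def]
    refine zsmul_mem ?_ _
    rw [MultilinearMap.domDomCongr_apply, hF]
    refine aux_mem I _ (u * x (σ.symm k)) ?_ (I.mul_mem_right _ _ huI)
    rw [List.mem_ofFn]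
    exact ⟨σ.symm k, by simp⟩
  have h2 : MultilinearMap.alternatization (F x) (Function.update v k u) =
      b.repr ⟨u, huV⟩ k • MultilinearMap.alternatization (F x) v := by
    conv_lhs => rw [hu]
    rw [AlternatingMap.map_update_sum, Finset.sum_eq_single k]
    · rw [AlternatingMap.map_update_smul, Function.update_eq_self]
    · intro j _ hj
      rw [AlternatingMap.map_update_smul, AlternatingMap.map_update_self _ _ hj.symm, smul_zero]
    · simp
  rw [h2] at h1
  have h3 := I.mul_mem_left (algebraMap K A (b.repr ⟨u, huV⟩ k)⁻¹) _ h1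
  rwa [← Algebra.smul_def, smul_smul, inv_mul_cancel₀ hk, one_smul] at h3
end

section
/- Let A be a countable-dimensional associative unital algebra over a field K admitting a simple module with trivial annihilator and trivial endomorphism ring. Then A satisfies the countable separation property: there exists a sequence a_1, a_2, … of nonzero elements of A such that every nonzero two-sided ideal of A contains some a_i. -/
namespace CSPaux

/-- Linear endomorphisms of `A` preserving every two-sided ideal. -/
def Pres {K A : Type*} [Field K] [Ring A] [Algebra K A] (φ : A →ₗ[K] A) : Prop :=
  ∀ I : TwoSidedIdeal A, ∀ a ∈ I, φ a ∈ I

/-- Ideal-preserving maps killing `s`. -/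
def Kill {K A : Type*} [Field K] [Ring A] [Algebra K A] (s : Set A) (φ : A →ₗ[K] A) : Prop :=
  Pres φ ∧ ∀ x ∈ s, φ x = 0

section
variable {K A : Type*} [Field K] [Ring A] [Algebra K A] {s : Set A} {φ ψ : A →ₗ[K] A}

lemma Kill.add (h : Kill s φ) (h' : Kill s ψ) : Kill s (φ + ψ) :=
  ⟨fun I a ha => I.add_mem (h.1 I a ha) (h'.1 I a ha),
    fun x hx => by simp [h.2 x hx, h'.2 x hx]⟩

lemma Kill.sub (h : Kill s φ) (h' : Kill s ψ) : Kill s (φ - ψ) :=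
  ⟨fun I a ha => I.sub_mem (h.1 I a ha) (h'.1 I a ha),
    fun x hx => by simp [h.2 x hx, h'.2 x hx]⟩

lemma Kill.left (h : Kill s φ) (r : A) : Kill s (LinearMap.mulLeft K r ∘ₗ φ) :=
  ⟨fun I a ha => I.mul_mem_left _ _ (h.1 I a ha), fun x hx => by simp [h.2 x hx]⟩

lemma Kill.right (h : Kill s φ) (r : A) : Kill s (LinearMap.mulRight K r ∘ₗ φ) :=
  ⟨fun I a ha => I.mul_mem_right _ _ (h.1 I a ha), fun x hx => by simp [h.2 x hx]⟩

lemma Kill.zero : Kill s (0 : A →ₗ[K] A) :=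
  ⟨fun I _ _ => I.zero_mem, fun x _ => by simp⟩

end

lemma exists_orbit {A M : Type*} [Ring A] [AddCommGroup M] [Module A M]
    (hsimple : IsSimpleModule A M) (v : M) (hv : v ≠ 0) (m : M) : ∃ x : A, x • v = m := by
  have : m ∈ Submodule.span A {v} := by
    rw [IsSimpleModule.span_singleton_eq_top A hv]; trivial
  exact Submodule.mem_span_singleton.1 this

lemma step {K A M : Type*} [Field K] [Ring A] [Algebra K A]
    [AddCommGroup M] [Module A M] [Module K M] [IsScalarTower K A M]
    (hsimple : IsSimpleModule A M)
    (hfaithful : ∀ a : A, (∀ m : M, a • m = 0) → a = 0)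
    (hend : ∀ f : M →ₗ[A] M, ∃ c : K, ∀ m : M, f m = c • m)
    (s : Set A) (a b : A)
    (h : ∀ φ : A →ₗ[K] A, Kill (insert a s) φ → φ b = 0) :
    ∃ c : K, ∀ φ : A →ₗ[K] A, Kill s φ → φ (b - c • a) = 0 := by
  have h0 : ∀ φ : A →ₗ[K] A, Kill s φ → φ a = 0 → φ b = 0 := by
    intro φ hφ ha
    refine h φ ⟨hφ.1, ?_⟩
    rintro x (rfl | hx)
    · exact ha
    · exact hφ.2 x hx
  by_cases hL : ∀ φ : A →ₗ[K] A, Kill s φ → φ a = 0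
  · exact ⟨0, fun φ hφ => by simpa using h0 φ hφ (hL φ hφ)⟩
  push Not at hL
  obtain ⟨φ₀, hφ₀, hne⟩ := hL
  have comm : ∀ ψ χ : A →ₗ[K] A, Kill s ψ → Kill s χ → ψ b * χ a = ψ a * χ b := by
    intro ψ χ hψ hχ
    have := h0 _ ((hψ.right (χ a)).sub (hχ.left (ψ a))) (by simp)
    simpa [sub_eq_zero] using this
  have hm0 : ∃ m : M, φ₀ a • m ≠ 0 := by
    by_contra hc
    push Not at hc
    exact hne (hfaithful _ hc)
  obtain ⟨m0, hm0⟩ := hm0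
  have surj : ∀ m : M, ∃ φ : A →ₗ[K] A, Kill s φ ∧ φ a • m0 = m := by
    intro m
    obtain ⟨x, hx⟩ := exists_orbit hsimple _ hm0 m
    exact ⟨_, hφ₀.left x, by simpa [mul_smul] using hx⟩
  have key : ∀ χ : A →ₗ[K] A, Kill s χ → χ a • m0 = 0 → χ b • m0 = 0 := by
    intro χ hχ hz
    by_contra hv
    apply hne
    apply hfaithful
    intro m
    obtain ⟨x, hx⟩ := exists_orbit hsimple _ hv m
    have e := comm _ χ (hφ₀.right x) hχ
    have e2 := congrArg (fun t : A => t • m0) e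
    simp only [mul_smul, hz, smul_zero] at e2
    simp only [LinearMap.comp_apply, LinearMap.mulRight_apply, mul_smul, hx] at e2
    exact e2.symm
  have key2 : ∀ φ χ : A →ₗ[K] A, Kill s φ → Kill s χ → φ a • m0 = χ a • m0 →
      φ b • m0 = χ b • m0 := by
    intro φ χ hφ hχ he
    have := key _ (hφ.sub hχ) (by simp [sub_smul, he])
    simpa [sub_smul, sub_eq_zero] using this
  choose F hF hFa using surj
  let g : M →ₗ[A] M :=
    { toFun := fun m => F m b • m0
      map_add' := fun x y => by
        have := key2 _ _ (hF (x + y)) ((hF x).add (hF y)) (by simp [add_smul, hFa])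
        simpa [add_smul] using this
      map_smul' := fun r x => by
        have := key2 _ _ (hF (r • x)) ((hF x).left r) (by simp [mul_smul, hFa])
        simpa [mul_smul] using this }
  obtain ⟨c, hc⟩ := hend g
  refine ⟨c, fun φ hφ => hfaithful _ fun m => ?_⟩
  have e : φ b • m = φ a • F m b • m0 := by
    have := congrArg (fun t : A => t • m0) (comm φ (F m) hφ (hF m))
    simpa only [mul_smul, hFa] using this
  have hcm : F m b • m0 = c • m := hc m
  rw [hcm, ← algebraMap_smul A c m, ← mul_smul, ← Algebra.commutes, ← Algebra.smul_def] at e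
  simp [sub_smul, e]

lemma mem_span {K A M : Type*} [Field K] [Ring A] [Algebra K A]
    [AddCommGroup M] [Module A M] [Module K M] [IsScalarTower K A M]
    (hsimple : IsSimpleModule A M)
    (hfaithful : ∀ a : A, (∀ m : M, a • m = 0) → a = 0)
    (hend : ∀ f : M →ₗ[A] M, ∃ c : K, ∀ m : M, f m = c • m)
    (s : Set A) (hs : s.Finite) :
    ∀ b : A, (∀ φ : A →ₗ[K] A, Kill s φ → φ b = 0) → b ∈ Submodule.span K s := by
  induction s, hs using Set.Finite.induction_on with
  | empty =>
    intro b h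
    have : b = 0 := h LinearMap.id ⟨fun I a ha => ha, by simp⟩
    simp [this]
  | @insert a s _ _ ih =>
    intro b h
    obtain ⟨c, hc⟩ := step hsimple hfaithful hend s a b h
    have h1 := ih _ hc
    rw [Submodule.mem_span_insert]
    exact ⟨c, _, h1, by abel⟩

end CSPaux

open CSPaux in
theorem stmt_3 {K A M : Type*} [Field K] [Ring A] [Algebra K A]
    [AddCommGroup M] [Module A M] [Module K M] [IsScalarTower K A M]
    (hcount : Module.rank K A ≤ Cardinal.aleph0)
    (hsimple : IsSimpleModule A M)
    (hfaithful : ∀ a : A, (∀ m : M, a • m = 0) → a = 0)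
    (hend : ∀ f : M →ₗ[A] M, ∃ c : K, ∀ m : M, f m = c • m) :
    ∃ a : ℕ → A, (∀ n, a n ≠ 0) ∧
      ∀ I : TwoSidedIdeal A, I ≠ ⊥ → ∃ n, a n ∈ I := by
  classical
  have hMn : Nontrivial M := IsSimpleModule.nontrivial A M
  have hAn : Nontrivial A := Module.nontrivial A M
  have e := Module.Basis.ofVectorSpace K A
  have hι : Countable (Module.Basis.ofVectorSpaceIndex K A) := by
    rw [← Cardinal.mk_le_aleph0_iff, e.mk_eq_rank'']
    exact hcount
  generalize Module.Basis.ofVectorSpaceIndex K A = ι0 at e hι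
  have hne : Nonempty ι0 := e.index_nonempty
  let T := {p : Finset ι0 × ι0 // p.2 ∉ p.1}
  have hT : Nonempty T := ⟨⟨(∅, Classical.arbitrary ι0), by simp⟩⟩
  have ex : ∀ p : T, ∃ φ : A →ₗ[K] A, Kill (e '' (p.1.1 : Set ι0)) φ ∧ φ (e p.1.2) ≠ 0 := by
    rintro ⟨⟨s, i⟩, hi⟩
    by_contra hc
    push Not at hc
    have := mem_span hsimple hfaithful hend (e '' (s : Set ι0)) (s.finite_toSet.image _) _ hc
    exact hi (Finset.mem_coe.1 (e.self_mem_span_image.1 this))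
  choose φ hφ hφne using ex
  obtain ⟨f, hf⟩ := exists_surjective_nat T
  refine ⟨fun n => φ (f n) (e (f n).1.2), fun n => hφne _, fun I hI => ?_⟩
  obtain ⟨x, hx, hx0⟩ : ∃ x ∈ I, x ≠ 0 := by
    by_contra hc
    push Not at hc
    apply hI
    rw [eq_bot_iff]
    intro x hx
    rw [hc x hx]
    exact TwoSidedIdeal.zero_mem _
  have hr : e.repr x ≠ 0 := by simpa using hx0
  obtain ⟨i, hi⟩ := Finsupp.support_nonempty_iff.2 hr
  let p : T := ⟨((e.repr x).support.erase i, i), by simp⟩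
  obtain ⟨n, hn⟩ := hf p
  refine ⟨n, ?_⟩
  simp only [hn]
  have hval : φ p x = e.repr x i • φ p (e i) := by
    conv_lhs => rw [← e.linearCombination_repr x, Finsupp.linearCombination_apply, Finsupp.sum,
      map_sum]
    rw [Finset.sum_eq_single_of_mem i hi]
    · simp
    · intro j hj hji
      rw [map_smul, (hφ p).2 (e j) ⟨j, by simpa [p, hji] using hj, rfl⟩, smul_zero]
  have hci : e.repr x i ≠ 0 := by simpa using hi
  have : φ p (e i) = algebraMap K A (e.repr x i)⁻¹ * φ p x := by
    rw [hval, ← Algebra.smul_def, smul_smul, inv_mul_cancel₀ hci, one_smul]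
  change φ p (e i) ∈ I
  rw [this]
  exact I.mul_mem_left _ _ ((hφ p).1 I x hx)
end
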